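/- Fix T > 0. For every exotic coloured tree τ whose graph obtained by identifying each β-pair to a single vertex is acyclic, and every t ∈ [0, T], Π^e_t(τ) = Σ_{τ̄ ∈ R(τ)} Π_t(τ̄), where the sum runs with multiplicity over the multiset R(τ) of reduced rooted trees of τ, and Π_t(τ̄) is the iterated Heaviside integral of the (uncoloured) rooted tree τ̄. -/

import Mathlib

/-- The two colours for non-root vertices of an exotic coloured tree. -/
inductive XColour : Type
  | alpha : XColour
  | beta : XColour
  deriving DecidableEq

/-- An exotic coloured tree: a finite non-planar rooted tree with vertex set
`Fin (n+1)`, distinguished (uncoloured) root `0`, edges oriented towards the root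
(encoded by the parent map), whose non-root vertices are coloured by `{α, β}`,
together with a fixed perfect pairing `mate` of the β-vertices (the exotic
decoration); in particular the number of β-vertices is even. -/
structure ExoticTree : Type where
  n : ℕ
  parent : Fin (n + 1) → Fin (n + 1)
  colour : Fin (n + 1) → Option XColour
  mate : Fin (n + 1) → Fin (n + 1)
  parent_root : parent 0 = 0
  reaches_root : ∀ v, parent^[n] v = 0
  colour_root : colour 0 = none
  colour_nonroot : ∀ v, v ≠ 0 → colour v ≠ none
  mate_beta : ∀ v, colour v = some XColour.beta →
      colour (mate v) = some XColour.beta ∧ mate (mate v) = v ∧ mate v ≠ v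
  mate_nonbeta : ∀ v, colour v ≠ some XColour.beta → mate v = v

namespace ExoticTree

/-- The number of children (incoming edges) `𝔫(v)` of a vertex. -/
def nChildren (t : ExoticTree) (v : Fin (t.n + 1)) : ℕ :=
  (Finset.univ.filter fun w => t.parent w = v ∧ w ≠ v).card

/-- A vertex is a leaf if it has no children. -/
def IsLeaf (t : ExoticTree) (v : Fin (t.n + 1)) : Prop := ∀ w, t.parent w = v → w = v

/-- The number of α-vertices. -/
def numAlpha (t : ExoticTree) : ℕ :=
  (Finset.univ.filter fun v : Fin (t.n + 1) => t.colour v = some XColour.alpha).card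

/-- The number of β-vertices. -/
def numBeta (t : ExoticTree) : ℕ :=
  (Finset.univ.filter fun v : Fin (t.n + 1) => t.colour v = some XColour.beta).card

/-- The number of β-pairs (each pair represented by its smaller member). -/
def numPairs (t : ExoticTree) : ℕ :=
  (Finset.univ.filter fun v : Fin (t.n + 1) =>
    t.colour v = some XColour.beta ∧ v < t.mate v).card

/-- The effective size `|τ|`: `1` (the root) plus the number of α-vertices plus the
number of β-pairs. -/
def effSize (t : ExoticTree) : ℕ := 1 + t.numAlpha + t.numPairs

/-- The edge grading `𝔩(τ) = |τ| − 1`. -/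
def edgeCount (t : ExoticTree) : ℕ := t.effSize - 1

/-- Isomorphism of exotic coloured trees: a root-preserving bijection of the vertices
commuting with the parent maps and preserving colours and the β-pairings. -/
def Iso (t₁ t₂ : ExoticTree) : Prop :=
  ∃ e : Fin (t₁.n + 1) ≃ Fin (t₂.n + 1), e 0 = 0 ∧
    (∀ v, t₂.parent (e v) = e (t₁.parent v)) ∧
    (∀ v, t₂.colour (e v) = t₁.colour v) ∧
    (∀ v, t₂.mate (e v) = e (t₁.mate v))

/-- The symmetry factor `σₑ(τ)`: the order of the group of automorphisms (root-preserving
tree automorphisms preserving colours and mapping paired β-vertices to paired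
β-vertices). -/
noncomputable def sigmaE (t : ExoticTree) : ℕ :=
  Nat.card {g : Equiv.Perm (Fin (t.n + 1)) //
    g 0 = 0 ∧ (∀ v, t.parent (g v) = g (t.parent v)) ∧
    (∀ v, t.colour (g v) = t.colour v) ∧ (∀ v, t.mate (g v) = g (t.mate v))}


/-- The Heaviside step function with the Itô prescription `Θ(x) = 1` for `x > 0`
and `Θ(x) = 0` for `x ≤ 0`. -/
noncomputable def Heaviside (x : ℝ) : ℝ := if 0 < x then 1 else 0

/-- The integration variables of the realization map: one per α-vertex and one shared
per β-pair (the pair represented by its smaller member). -/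
def itemSet (t : ExoticTree) : Finset (Fin (t.n + 1)) :=
  Finset.univ.filter fun v =>
    t.colour v = some XColour.alpha ∨
      (t.colour v = some XColour.beta ∧ v < t.mate v)

/-- The representative carrying the integration variable of a vertex: a β-vertex
shares the variable of its mate (both members of a pair carry the same variable). -/
def timeRep (t : ExoticTree) (v : Fin (t.n + 1)) : Fin (t.n + 1) :=
  if t.colour v = some XColour.beta ∧ t.mate v < v then t.mate v else v

/-- The time assigned to a vertex: the root's variable is fixed to `time`, every other
vertex carries the integration variable of its representative. -/
noncomputable def vertexTime (t : ExoticTree) (time : ℝ)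
    (x : {v : Fin (t.n + 1) // v ∈ t.itemSet} → ℝ) (v : Fin (t.n + 1)) : ℝ :=
  if h : t.timeRep v ∈ t.itemSet then x ⟨t.timeRep v, h⟩ else time

/-- The exotic realization map `Π^e_time(t)`: the integral over `[0,T]^{𝔩(t)}` (one
variable per α-vertex, one shared variable per β-pair, the root's variable fixed to
`time`) of the product over all edges `e = (parent, child)` of
`Θ(t_parent − t_child)`. -/
noncomputable def realize (t : ExoticTree) (T time : ℝ) : ℝ :=
  ∫ x in Set.univ.pi fun _ : {v : Fin (t.n + 1) // v ∈ t.itemSet} => Set.Icc (0 : ℝ) T,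
    ∏ v ∈ Finset.univ.filter fun v : Fin (t.n + 1) => v ≠ 0,
      Heaviside (t.vertexTime time x (t.parent v) - t.vertexTime time x v)

end ExoticTree

open ExoticTree

/-- A plain (uncoloured) finite non-planar rooted tree: vertex set `Fin (n+1)`,
root `0`, edges oriented towards the root, encoded by the parent map. -/
structure PTree : Type where
  n : ℕ
  parent : Fin (n + 1) → Fin (n + 1)
  parent_root : parent 0 = 0
  reaches_root : ∀ v, parent^[n] v = 0

namespace PTree

/-- The iterated Heaviside integral `Π_time(s)` of an uncoloured rooted tree: the
integral over `[0,T]^{#non-root vertices}` (the root's variable fixed to `time`) of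
the product over all edges `e = (parent, child)` of `Θ(t_parent − t_child)`. -/
noncomputable def realize (s : PTree) (T time : ℝ) : ℝ :=
  ∫ x in Set.univ.pi fun _ : {v : Fin (s.n + 1) // v ≠ 0} => Set.Icc (0 : ℝ) T,
    ∏ v ∈ Finset.univ.filter fun v : Fin (s.n + 1) => v ≠ 0,
      ExoticTree.Heaviside
        ((if h : s.parent v = 0 then time else x ⟨s.parent v, h⟩) -
          if h : v = (0 : Fin (s.n + 1)) then time else x ⟨v, h⟩)

end PTree

namespace ExoticTree

/-- A step of the directed graph obtained from `t` by identifying each β-pair to a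
single vertex: there is an edge from the class of `x` to the class of `y` if some
member of the class of `x` is a non-root vertex whose parent is in the class of `y`. -/
def IdStep (t : ExoticTree) (x y : Fin (t.n + 1)) : Prop :=
  ∃ u, (u = x ∨ u = t.mate x) ∧ u ≠ 0 ∧ (t.parent u = y ∨ t.parent u = t.mate y)

/-- The graph obtained from `t` by identifying each β-pair to a single vertex is
acyclic (no directed cycles). -/
def IdAcyclic (t : ExoticTree) : Prop := ∀ x, ¬ Relation.TransGen (t.IdStep) x x

/-- The depth of a vertex: the number of edges on the path to the root. -/
noncomputable def depth (t : ExoticTree) (v : Fin (t.n + 1)) : ℕ :=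
  letI : DecidablePred fun k => t.parent^[k] v = 0 := fun _ => inferInstance
  Nat.find (⟨t.n, t.reaches_root v⟩ : ∃ k, t.parent^[k] v = 0)

/-- `parent^[d₁] b = parent^[d₂] (mate b)` is the first common vertex of the two
downward closing paths issued from the β-pair `b`, `mate b`. -/
def FirstCommon (t : ExoticTree) (b : Fin (t.n + 1)) (d₁ d₂ : ℕ) : Prop :=
  0 < d₁ ∧ 0 < d₂ ∧ t.parent^[d₁] b = t.parent^[d₂] (t.mate b) ∧
    ∀ i < d₁, ∀ j < d₂, t.parent^[i] b ≠ t.parent^[j] (t.mate b)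

/-- The closed branch of the β-pair `b`, `mate b` is (one of those) nearest to the
root: its base has minimal depth among the bases of all closed branches. -/
def NearestPair (t : ExoticTree) (b : Fin (t.n + 1)) (d₁ d₂ : ℕ) : Prop :=
  FirstCommon t b d₁ d₂ ∧
    ∀ b' d₁' d₂', t.colour b' = some XColour.beta → FirstCommon t b' d₁' d₂' →
      t.depth (t.parent^[d₁] b) ≤ t.depth (t.parent^[d₁'] b')

/-- `v` is an internal vertex of one of the two closing paths of the closed branch
of the β-pair `b`, `mate b`. -/
def OnClosingPath (t : ExoticTree) (b : Fin (t.n + 1)) (d₁ d₂ : ℕ)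
    (v : Fin (t.n + 1)) : Prop :=
  (∃ i, 0 < i ∧ i < d₁ ∧ v = t.parent^[i] b) ∨
    ∃ j, 0 < j ∧ j < d₂ ∧ v = t.parent^[j] (t.mate b)

end ExoticTree

/-- A shuffle of two chains of lengths `a` and `b`: an interleaving of their elements
into a single chain of length `a + b` preserving the relative order within each
chain. -/
def ShuffleT (a b : ℕ) : Type :=
  {p : (Fin a → Fin (a + b)) × (Fin b → Fin (a + b)) //
    (∀ i j, i < j → p.1 i < p.1 j) ∧ (∀ i j, i < j → p.2 i < p.2 j) ∧
      ∀ x, (∃ i, p.1 i = x) ∨ ∃ j, p.2 j = x}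

instance (a b : ℕ) : Fintype (ShuffleT a b) := by
  unfold ShuffleT; infer_instance

namespace ExoticTree

/-- `t'` is (a copy of) the exotic coloured tree obtained from `t` by merging the two
closing paths of the closed branch of the β-pair `b`, `mate b` into a single path,
interleaving their internal vertices according to the shuffle `sh` (the pair itself
is identified to a single vertex, placed at the top of the merged path, and all other
vertices, colours, β-pairings and subtrees are carried along unchanged). -/
def IsMergeAt (t : ExoticTree) (b : Fin (t.n + 1)) (d₁ d₂ : ℕ)
    (sh : ShuffleT (d₁ - 1) (d₂ - 1)) (t' : ExoticTree) : Prop :=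
  t.n = t'.n + 1 ∧
  ∃ φ : Fin (t.n + 1) → Fin (t'.n + 1),
    Function.Surjective φ ∧ φ 0 = 0 ∧ φ b = φ (t.mate b) ∧
    (∀ u v, φ u = φ v → u = v ∨ ((u = b ∨ u = t.mate b) ∧ (v = b ∨ v = t.mate b))) ∧
    (∀ v, v ≠ b → v ≠ t.mate b → t'.colour (φ v) = t.colour v) ∧
    t'.colour (φ b) = some XColour.alpha ∧
    (∀ v, v ≠ b → v ≠ t.mate b → t'.mate (φ v) = φ (t.mate v)) ∧
    t'.mate (φ b) = φ b ∧
    (∀ v, v ≠ b → v ≠ t.mate b → ¬ t.OnClosingPath b d₁ d₂ v →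
      t'.parent (φ v) = φ (t.parent v)) ∧
    ∃ ch : Fin (d₁ - 1 + (d₂ - 1) + 1) → Fin (t'.n + 1),
      ch (Fin.last _) = φ b ∧
      t'.parent (ch 0) = φ (t.parent^[d₁] b) ∧
      (∀ i : Fin (d₁ - 1 + (d₂ - 1)), t'.parent (ch i.succ) = ch i.castSucc) ∧
      (∀ i : Fin (d₁ - 1), ch ((sh.1.1 i).castSucc) = φ (t.parent^[d₁ - 1 - (i : ℕ)] b)) ∧
      ∀ j : Fin (d₂ - 1), ch ((sh.1.2 j).castSucc) = φ (t.parent^[d₂ - 1 - (j : ℕ)] (t.mate b))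

end ExoticTree

open ExoticTree

/-- `IsReduction t M`: `M` is the reduction multiset `R(t)` of the exotic coloured
tree `t`.  If `t` has no β-vertices, `R(t)` is the singleton of the underlying
uncoloured rooted tree; otherwise one successively merges the two closing paths of
the closed branch nearest to the root, in every interleaving (shuffle) preserving the
relative order of the vertices within each closing path, and takes the multiset sum
over all shuffles (one reduced tree per choice of shuffles). -/
inductive IsReduction : ExoticTree → Multiset PTree → Prop where
  | base (t : ExoticTree) (s : PTree) (h0 : t.numBeta = 0)
      (hiso : ∃ e : Fin (t.n + 1) ≃ Fin (s.n + 1), e 0 = 0 ∧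
        ∀ v, s.parent (e v) = e (t.parent v)) :
      IsReduction t {s}
  | merge (t : ExoticTree) (b : Fin (t.n + 1)) (d₁ d₂ : ℕ)
      (hβ : t.colour b = some XColour.beta)
      (hnear : t.NearestPair b d₁ d₂)
      (next : ShuffleT (d₁ - 1) (d₂ - 1) → ExoticTree)
      (Ms : ShuffleT (d₁ - 1) (d₂ - 1) → Multiset PTree)
      (hmerge : ∀ sh, t.IsMergeAt b d₁ d₂ sh (next sh))
      (hnext : ∀ sh, IsReduction (next sh) (Ms sh)) :
      IsReduction t (∑ sh : ShuffleT (d₁ - 1) (d₂ - 1), Ms sh)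

/-- The time of a vertex whose label is `ℓ v`: unlabelled vertices carry the fixed time `x`. -/
def labelTime {V ι : Type*} (ℓ : V → Option ι) (x : ℝ) (y : ι → ℝ) (v : V) : ℝ :=
  (ℓ v).elim x y

/-- The times strictly increase along every edge of the tree with root `r` and parent map `p`. -/
def Increasing {V : Type*} (r : V) (p : V → V) (c : V → ℝ) : Prop :=
  ∀ v, v ≠ r → c v < c (p v)

open scoped Classical in
/-- The volume of the labelled times in `[0, T]` increasing along every edge. -/
noncomputable def labelIntegral {V ι : Type*} [Fintype ι] (r : V) (p : V → V)
    (ℓ : V → Option ι) (T x : ℝ) : ℝ :=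
  ∫ y in Set.univ.pi fun _ : ι => Set.Icc (0 : ℝ) T,
    if Increasing r p (labelTime ℓ x y) then (1 : ℝ) else 0

open scoped Classical in
theorem prod_heaviside_eq {V : Type*} [Fintype V] (r : V) (p : V → V) (c : V → ℝ)
    [DecidablePred fun v : V => v ≠ r] :
    ∏ v ∈ Finset.univ.filter (fun v : V => v ≠ r), Heaviside (c (p v) - c v) =
      if Increasing r p c then (1 : ℝ) else 0 := by
  simp only [Heaviside, sub_pos, Finset.prod_boole, Finset.mem_filter, Finset.mem_univ, true_and]
  exact if_congr Iff.rfl rfl rfl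

theorem labelIntegral_congr {V ι κ : Type*} [Fintype ι] [Fintype κ] (r : V) (p : V → V)
    {ℓ : V → Option ι} {ℓ' : V → Option κ} (hℓ : ∀ i, ∃ v, ℓ v = some i)
    (hℓ' : ∀ i, ∃ v, ℓ' v = some i) (hnone : ∀ v, ℓ v = none ↔ ℓ' v = none)
    (heq : ∀ u v, ℓ u = ℓ v ↔ ℓ' u = ℓ' v) (T x : ℝ) :
    labelIntegral r p ℓ T x = labelIntegral r p ℓ' T x := by
  classical
  choose g hg using hℓ
  have hsome : ∀ i, ∃ k, ℓ' (g i) = some k := fun i =>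
    Option.ne_none_iff_exists'.1 fun h => by simpa [hg] using (hnone _).2 h
  choose f hf using hsome
  have hfspec : ∀ v i, ℓ v = some i → ℓ' v = some (f i) := fun v i hv => by
    rw [← hf i]; exact (heq _ _).1 (by rw [hv, hg])
  have hbij : Function.Bijective f := by
    constructor
    · intro i j hij
      have : ℓ' (g i) = ℓ' (g j) := by rw [hf, hf, hij]
      have := (heq _ _).2 this
      rw [hg, hg] at this
      exact Option.some.inj this
    · intro k
      obtain ⟨v, hv⟩ := hℓ' k
      obtain ⟨i, hi⟩ : ∃ i, ℓ v = some i :=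
        Option.ne_none_iff_exists'.1 fun h => by simp [(hnone _).1 h] at hv
      exact ⟨i, Option.some.inj ((hfspec v i hi).symm.trans hv)⟩
  let e : ι ≃ κ := Equiv.ofBijective f hbij
  have htime : ∀ y : ι → ℝ, labelTime ℓ' x (MeasurableEquiv.piCongrLeft (fun _ => ℝ) e y) =
      labelTime ℓ x y := by
    intro y
    funext v
    rcases h : ℓ v with _ | i
    · simp [labelTime, h, (hnone v).1 h]
    · simp only [labelTime, h, hfspec v i h, Option.elim]
      exact Equiv.piCongrLeft_apply_apply (fun _ => ℝ) e y i
  have key := (MeasureTheory.volume_measurePreserving_piCongrLeft (fun _ : κ => ℝ)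
    e).setIntegral_preimage_emb (MeasurableEquiv.measurableEmbedding _)
    (fun y => if Increasing r p (labelTime ℓ' x y) then (1 : ℝ) else 0)
    (Set.univ.pi fun _ : κ => Set.Icc (0 : ℝ) T)
  simp only [htime] at key
  unfold labelIntegral
  rw [← key]
  congr 2
  ext y
  simp only [Set.mem_preimage, Set.mem_univ_pi]
  constructor
  · intro h k
    obtain ⟨i, rfl⟩ := e.surjective k
    have : MeasurableEquiv.piCongrLeft (fun _ => ℝ) e y (e i) = y i :=
      Equiv.piCongrLeft_apply_apply (fun _ => ℝ) e y i
    rw [this]; exact h i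
  · intro h i
    have : MeasurableEquiv.piCongrLeft (fun _ => ℝ) e y (e i) = y i :=
      Equiv.piCongrLeft_apply_apply (fun _ => ℝ) e y i
    rw [← this]; exact h _

open scoped Classical in
theorem labelIntegral_equiv {V W ι : Type*} [Fintype ι] (e : V ≃ W) {r : V} {p : V → V}
    {q : W → W} (hq : ∀ v, q (e v) = e (p v)) (ℓ : W → Option ι) (T x : ℝ) :
    labelIntegral (e r) q ℓ T x = labelIntegral r p (fun v => ℓ (e v)) T x := by
  have : ∀ y, Increasing (e r) q (labelTime ℓ x y) ↔
      Increasing r p (labelTime (fun v => ℓ (e v)) x y) := fun y => by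
    simp only [Increasing, e.forall_congr_left (p := fun v => v ≠ r → _)]
    simp [labelTime, ← hq, Equiv.symm_apply_eq]
  unfold labelIntegral
  congr 1
  funext y
  exact if_congr (this y) rfl rfl

theorem measurable_labelTime {V ι : Type*} (ℓ : V → Option ι) (x : ℝ) (v : V) :
    Measurable fun y : ι → ℝ => labelTime ℓ x y v := by
  rcases h : ℓ v with _ | i
  · simp [labelTime, h]
  · simpa [labelTime, h] using measurable_pi_apply i

theorem measurableSet_increasing {V ι : Type*} [Countable V] (r : V) (p : V → V)
    (ℓ : V → Option ι) (x : ℝ) :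
    MeasurableSet {y : ι → ℝ | Increasing r p (labelTime ℓ x y)} := by
  simp only [Increasing, Set.ofPred_forall]
  exact MeasurableSet.iInter fun v => MeasurableSet.iInter fun _ =>
    measurableSet_lt (measurable_labelTime ℓ x v) (measurable_labelTime ℓ x (p v))

open scoped Classical in
theorem integrableOn_increasing {V ι : Type*} [Countable V] [Fintype ι] (r : V) (p : V → V)
    (ℓ : V → Option ι) (T x : ℝ) :
    MeasureTheory.IntegrableOn
      (fun y : ι → ℝ => if Increasing r p (labelTime ℓ x y) then (1 : ℝ) else 0)
      (Set.univ.pi fun _ : ι => Set.Icc (0 : ℝ) T) := by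
  refine MeasureTheory.Measure.integrableOn_of_bounded (M := 1) ?_ ?_ ?_
  · exact (isCompact_univ_pi fun _ => isCompact_Icc).measure_lt_top.ne
  · exact (Measurable.ite (measurableSet_increasing r p ℓ x) measurable_const
      measurable_const).aestronglyMeasurable
  · exact Filter.Eventually.of_forall fun y => by split_ifs <;> simp

theorem ae_injective (ι : Type*) [Fintype ι] :
    ∀ᵐ y : ι → ℝ, Function.Injective y := by
  have h : ∀ i j : ι, i ≠ j → ∀ᵐ y : ι → ℝ, y i ≠ y j := by
    classical
    intro i j hij
    let f : (ι → ℝ) →ₗ[ℝ] ℝ :=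
      (LinearMap.proj i : (ι → ℝ) →ₗ[ℝ] ℝ) - LinearMap.proj j
    have hf : LinearMap.ker f ≠ ⊤ := fun htop => by
      have : Pi.single i (1 : ℝ) ∈ LinearMap.ker f := htop ▸ Submodule.mem_top
      simp [f, hij.symm] at this
    refine MeasureTheory.measure_mono_null ?_
      (MeasureTheory.Measure.addHaar_submodule MeasureTheory.volume _ hf)
    intro y hy
    simpa [f, sub_eq_zero] using hy
  have h' : ∀ᵐ y : ι → ℝ, ∀ i j : ι, i ≠ j → y i ≠ y j := by
    simpa only [MeasureTheory.ae_all_iff] using h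
  filter_upwards [h'] with y hy i j hij
  by_contra hne
  exact hy i j hne hij

theorem labelIntegral_eq_sum {S V ι : Type*} [Fintype S] [Fintype ι] [Countable V]
    {W : S → Type*} [∀ s, Countable (W s)]
    (r : V) (p : V → V) (ℓ : V → Option ι) (r' : ∀ s, W s) (p' : ∀ s, W s → W s)
    (ℓ' : ∀ s, W s → Option ι) (T x : ℝ)
    (h : ∀ y : ι → ℝ, Function.Injective y →
      (Increasing r p (labelTime ℓ x y) →
        ∃ s, Increasing (r' s) (p' s) (labelTime (ℓ' s) x y)) ∧
      (∀ s, Increasing (r' s) (p' s) (labelTime (ℓ' s) x y) →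
        Increasing r p (labelTime ℓ x y)) ∧
      ∀ s₁ s₂, Increasing (r' s₁) (p' s₁) (labelTime (ℓ' s₁) x y) →
        Increasing (r' s₂) (p' s₂) (labelTime (ℓ' s₂) x y) → s₁ = s₂) :
    labelIntegral r p ℓ T x = ∑ s, labelIntegral (r' s) (p' s) (ℓ' s) T x := by
  classical
  unfold labelIntegral
  rw [← MeasureTheory.integral_finsetSum _
    fun s _ => integrableOn_increasing (r' s) (p' s) (ℓ' s) T x]
  refine MeasureTheory.setIntegral_congr_ae
    (MeasurableSet.univ_pi fun _ => measurableSet_Icc) ?_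
  filter_upwards [ae_injective ι] with y hy _
  obtain ⟨h₁, h₂, h₃⟩ := h y hy
  by_cases hP : Increasing r p (labelTime ℓ x y)
  · obtain ⟨s, hs⟩ := h₁ hP
    rw [if_pos hP, Finset.sum_eq_single s, if_pos hs]
    · intro s' _ hne
      exact if_neg fun hs' => hne (h₃ _ _ hs' hs)
    · simp
  · rw [if_neg hP, Finset.sum_eq_zero]
    exact fun s _ => if_neg fun hs => hP (h₂ s hs)

namespace ExoticTree

theorem colour_mate_eq_beta_iff (t : ExoticTree) (v : Fin (t.n + 1)) :
    t.colour (t.mate v) = some XColour.beta ↔ t.colour v = some XColour.beta := by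
  by_cases h : t.colour v = some XColour.beta
  · simp [h, (t.mate_beta v h).1]
  · rw [t.mate_nonbeta v h]

theorem mate_mate (t : ExoticTree) (v : Fin (t.n + 1)) : t.mate (t.mate v) = v := by
  by_cases h : t.colour v = some XColour.beta
  · exact (t.mate_beta v h).2.1
  · rw [t.mate_nonbeta v h, t.mate_nonbeta v h]

theorem ne_zero_of_colour (t : ExoticTree) {v : Fin (t.n + 1)} {c : XColour}
    (h : t.colour v = some c) : v ≠ 0 := by
  rintro rfl
  simp [t.colour_root] at h

theorem iterate_parent_zero (t : ExoticTree) (k : ℕ) : t.parent^[k] 0 = 0 :=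
  Function.iterate_fixed t.parent_root k

theorem eq_zero_of_iterate_parent_eq_self (t : ExoticTree) {v : Fin (t.n + 1)} {k : ℕ}
    (hk : 0 < k) (h : t.parent^[k] v = v) : v = 0 := by
  have h₁ : t.parent^[k * t.n] v = v := by
    rw [Function.iterate_mul]; exact Function.iterate_fixed h _
  obtain ⟨m, hm⟩ := Nat.exists_eq_add_of_le (Nat.le_mul_of_pos_left t.n hk)
  have h₂ : t.parent^[k * t.n] v = 0 := by
    simp only [hm, Nat.add_comm t.n m, Function.iterate_add_apply, t.reaches_root,
      t.iterate_parent_zero]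
  exact h₁.symm.trans h₂

/-- `ℓ` assigns labels to the non-root vertices, equal exactly on paired vertices, using every
label. -/
structure IsLabelling (t : ExoticTree) {ι : Type*} (ℓ : Fin (t.n + 1) → Option ι) : Prop where
  eq_none_iff : ∀ v, ℓ v = none ↔ v = 0
  eq_iff : ∀ u v, ℓ u = ℓ v ↔ u = v ∨ u = t.mate v
  exists_eq_some : ∀ i, ∃ v, ℓ v = some i

/-- The labelling of the vertices by their integration variables. -/
def label (t : ExoticTree) (v : Fin (t.n + 1)) : Option {v : Fin (t.n + 1) // v ∈ t.itemSet} :=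
  if h : t.timeRep v ∈ t.itemSet then some ⟨t.timeRep v, h⟩ else none

theorem timeRep_mem_itemSet_iff (t : ExoticTree) (v : Fin (t.n + 1)) :
    t.timeRep v ∈ t.itemSet ↔ v ≠ 0 := by
  constructor
  · rintro h rfl
    simp [timeRep, itemSet, t.colour_root] at h
  · intro hv
    rcases h : t.colour v with _ | ⟨_ | _⟩
    · exact absurd h (t.colour_nonroot v hv)
    · simp [timeRep, itemSet, h]
    · obtain ⟨h₁, h₂, h₃⟩ := t.mate_beta v h
      by_cases hlt : t.mate v < v
      · simp [timeRep, itemSet, h, hlt, h₁, h₂]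
      · simp only [timeRep, itemSet, h, hlt]
        simpa [h] using lt_of_le_of_ne (not_lt.1 hlt) h₃.symm

theorem timeRep_eq_iff (t : ExoticTree) (u v : Fin (t.n + 1)) :
    t.timeRep u = t.timeRep v ↔ u = v ∨ u = t.mate v := by
  have hmin : ∀ w, t.timeRep w = min w (t.mate w) := by
    intro w
    unfold timeRep
    split_ifs with h
    · exact (min_eq_right h.2.le).symm
    · by_cases hw : t.colour w = some XColour.beta
      · exact (min_eq_left (not_lt.1 fun hlt => h ⟨hw, hlt⟩)).symm
      · simp [t.mate_nonbeta w hw]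
  rw [hmin, hmin]
  constructor
  · intro h
    rcases min_choice u (t.mate u) with hu | hu <;> rcases min_choice v (t.mate v) with hv | hv <;>
      rw [hu, hv] at h
    · exact Or.inl h
    · exact Or.inr h
    · rw [← h, t.mate_mate]; exact Or.inr rfl
    · rw [← t.mate_mate u, h, t.mate_mate]; exact Or.inl rfl
  · rintro (rfl | rfl)
    · rfl
    · rw [t.mate_mate, min_comm]

theorem isLabelling_label (t : ExoticTree) : t.IsLabelling t.label where
  eq_none_iff v := by
    simp [label, timeRep_mem_itemSet_iff]
  eq_iff u v := by
    rw [← timeRep_eq_iff]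
    simp only [label]
    by_cases hu : u = 0 <;> by_cases hv : v = 0
    · simp [hu, hv]
    · have h₁ := (t.timeRep_mem_itemSet_iff v).2 hv
      have h₂ := (not_congr (t.timeRep_mem_itemSet_iff u)).2 (not_not.2 hu)
      rw [dif_neg h₂, dif_pos h₁]
      simpa using fun h : t.timeRep u = t.timeRep v => h₂ (h ▸ h₁)
    · have h₁ := (t.timeRep_mem_itemSet_iff u).2 hu
      have h₂ := (not_congr (t.timeRep_mem_itemSet_iff v)).2 (not_not.2 hv)
      rw [dif_neg h₂, dif_pos h₁]
      simpa using fun h : t.timeRep u = t.timeRep v => h₂ (h ▸ h₁)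
    · rw [dif_pos ((t.timeRep_mem_itemSet_iff v).2 hv),
        dif_pos ((t.timeRep_mem_itemSet_iff u).2 hu)]
      simp
  exists_eq_some i := by
    obtain ⟨v, hv⟩ := i
    have : t.timeRep v = v := by
      simp only [itemSet, Finset.mem_filter, Finset.mem_univ, true_and] at hv
      rcases hv with hv | ⟨_, hv⟩
      · simp [timeRep, hv]
      · simp [timeRep, hv.not_gt]
    refine ⟨v, ?_⟩
    simp [label, this, hv]

theorem realize_eq_labelIntegral (t : ExoticTree) {ι : Type*} [Fintype ι]
    {ℓ : Fin (t.n + 1) → Option ι} (hℓ : t.IsLabelling ℓ) (T x : ℝ) :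
    t.realize T x = labelIntegral 0 t.parent ℓ T x := by
  have hcan := t.isLabelling_label
  rw [← labelIntegral_congr 0 t.parent hcan.exists_eq_some hℓ.exists_eq_some
    (fun v => by rw [hcan.eq_none_iff, hℓ.eq_none_iff])
    (fun u v => by rw [hcan.eq_iff, hℓ.eq_iff])]
  have htime : ∀ y v, t.vertexTime x y v = labelTime t.label x y v := by
    intro y v
    simp only [vertexTime, labelTime, label]
    split_ifs <;> rfl
  unfold realize labelIntegral
  congr 1
  funext y
  rw [← prod_heaviside_eq]
  simp only [htime]

end ExoticTree

theorem PTree.realize_eq_labelIntegral (s : PTree) (T x : ℝ) :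
    s.realize T x = labelIntegral 0 s.parent
      (fun v => if h : v = 0 then none else some (⟨v, h⟩ : {v : Fin (s.n + 1) // v ≠ 0})) T x := by
  unfold PTree.realize labelIntegral
  congr 1
  funext y
  rw [← prod_heaviside_eq]
  refine Finset.prod_congr (by congr) fun v _ => ?_
  congr 2 <;> (simp only [labelTime]; split_ifs <;> rfl)

namespace ExoticTree

theorem realize_eq_of_numBeta_eq_zero (t : ExoticTree) (s : PTree) (h0 : t.numBeta = 0)
    (e : Fin (t.n + 1) ≃ Fin (s.n + 1)) (he : e 0 = 0)
    (hp : ∀ v, s.parent (e v) = e (t.parent v)) (T x : ℝ) :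
    t.realize T x = s.realize T x := by
  have hmate : ∀ v, t.mate v = v := fun v => by
    refine t.mate_nonbeta v fun h => ?_
    rw [numBeta, Finset.card_eq_zero] at h0
    simpa [h0] using (Finset.mem_filter_univ (p := fun v => t.colour v = some XColour.beta) v).2 h
  have key := labelIntegral_equiv e (r := 0) (p := t.parent) hp
    (fun v => if h : v = 0 then none else some (⟨v, h⟩ : {v : Fin (s.n + 1) // v ≠ 0})) T x
  rw [he] at key
  rw [s.realize_eq_labelIntegral, key]
  have h0 : ∀ v, e v = 0 ↔ v = 0 := fun v => by
    rw [← he, e.apply_eq_iff_eq]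
  refine t.realize_eq_labelIntegral ⟨fun v => ?_, fun u v => ?_, fun i => ?_⟩ T x
  · simp [h0]
  · rw [hmate, or_self]
    by_cases hu : u = 0 <;> by_cases hv : v = 0 <;> simp [h0, hu, hv]
    · exact fun h => hv h.symm
  · obtain ⟨w, hw⟩ := i
    exact ⟨e.symm w, by simp [hw]⟩

end ExoticTree

theorem val_eq_of_strictMono {a m : ℕ} (h : m = a) {s : Fin a → Fin m} (hs : StrictMono s)
    (i : Fin a) : (s i : ℕ) = i := by
  subst h
  exact congrArg Fin.val (le_antisymm hs.apply_le hs.le_apply)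

section Chain

variable {W : Type*} {q : W → W} {m : ℕ} {ch : Fin (m + 1) → W}

theorem iterate_chain (hsucc : ∀ i : Fin m, q (ch i.succ) = ch i.castSucc) (i : Fin (m + 1)) :
    ∀ (k j : ℕ) (hj : j < m + 1), j = i + k → q^[k] (ch ⟨j, hj⟩) = ch i := by
  intro k
  induction k with
  | zero =>
    intro j hj h
    simp only [Nat.add_zero] at h
    subst h
    rfl
  | succ k ih =>
    intro j hj h
    have hj' : j - 1 < m := by omega
    have h1 : (⟨j, hj⟩ : Fin (m + 1)) = (⟨j - 1, hj'⟩ : Fin m).succ :=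
      Fin.ext (by simp; omega)
    rw [Function.iterate_succ_apply, h1, hsucc]
    exact ih (j - 1) (by omega) (by omega)

theorem iterate_chain_of_le (hsucc : ∀ i : Fin m, q (ch i.succ) = ch i.castSucc)
    {i j : Fin (m + 1)} (h : i ≤ j) : q^[(j : ℕ) - i] (ch j) = ch i :=
  iterate_chain hsucc i _ j j.2 (by have : (i : ℕ) ≤ j := h; omega)

/-- `π` runs down from the top of the chain `ch` through the positions `s` of the chain
to the vertex below its bottom. -/
structure IsChainPath (q : W → W) (ch : Fin (m + 1) → W) (π : ℕ → W) (d : ℕ)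
    (s : Fin (d - 1) → Fin m) : Prop where
  pos : 0 < d
  strictMono : StrictMono s
  succ : ∀ i : Fin m, q (ch i.succ) = ch i.castSucc
  bottom : q (ch 0) = π d
  top : ch (Fin.last m) = π 0
  eq : ∀ i : Fin (d - 1), ch (s i).castSucc = π (d - 1 - i)

namespace IsChainPath

variable {π : ℕ → W} {d : ℕ} {s : Fin (d - 1) → Fin m}

theorem apply_eq (h : IsChainPath q ch π d s) {i : ℕ} (hi : 0 < i) (hid : i < d) :
    π i = ch (s ⟨d - 1 - i, by omega⟩).castSucc := by
  rw [h.eq]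
  congr 1
  simp only
  omega

theorem exists_pos (h : IsChainPath q ch π d s) {i : ℕ} (hid : i < d) :
    ∃ j, π i = ch j := by
  rcases Nat.eq_zero_or_pos i with rfl | hi
  · exact ⟨_, h.top.symm⟩
  · exact ⟨_, h.apply_eq hi hid⟩

theorem exists_iterate (h : IsChainPath q ch π d s) {i : ℕ} (hi : i < d) :
    ∃ k, 0 < k ∧ q^[k] (π i) = π (i + 1) := by
  rcases Nat.lt_or_ge (i + 1) d with hi1 | hi1
  · rw [h.apply_eq (Nat.succ_pos i) hi1]
    obtain ⟨j, hj, hlt⟩ : ∃ j, π i = ch j ∧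
        (s ⟨d - 1 - (i + 1), by omega⟩).castSucc < j := by
      rcases Nat.eq_zero_or_pos i with rfl | hi0
      · exact ⟨_, h.top.symm, Fin.castSucc_lt_last _⟩
      · refine ⟨_, h.apply_eq hi0 hi, ?_⟩
        rw [Fin.castSucc_lt_castSucc_iff]
        refine h.strictMono ?_
        rw [Fin.lt_def]
        simp only
        omega
    rw [hj]
    exact ⟨_, Nat.sub_pos_of_lt hlt, iterate_chain_of_le h.succ hlt.le⟩
  · obtain ⟨j, hj⟩ := h.exists_pos hi
    refine ⟨j + 1, Nat.succ_pos _, ?_⟩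
    rw [Function.iterate_succ_apply', hj]
    have := iterate_chain_of_le h.succ (Fin.zero_le j)
    simp only [Fin.val_zero, Nat.sub_zero] at this
    rw [this, h.bottom]
    congr 1
    omega

theorem apply_step_of_eq (h : IsChainPath q ch π d s) (hm : m = d - 1) {i : ℕ} (hi : i < d) :
    q (π i) = π (i + 1) := by
  have hpos : ∀ i (hi : i < d), π i = ch ⟨d - 1 - i, by omega⟩ := by
    intro i hi
    rcases Nat.eq_zero_or_pos i with rfl | hi0
    · rw [← h.top]
      congr 1
      exact Fin.ext (by simp [hm])
    · rw [h.apply_eq hi0 hi]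
      congr 1
      exact Fin.ext (by simp [val_eq_of_strictMono hm h.strictMono])
  rcases Nat.lt_or_ge (i + 1) d with hi1 | hi1
  · rw [hpos i hi, hpos _ hi1]
    have := h.succ ⟨d - 1 - (i + 1), by omega⟩
    have heq : (⟨d - 1 - i, by omega⟩ : Fin (m + 1)) =
        (⟨d - 1 - (i + 1), by omega⟩ : Fin m).succ := Fin.ext (by simp; omega)
    rw [heq, this]
    rfl
  · have h0 : (⟨d - 1 - i, by omega⟩ : Fin (m + 1)) = 0 := Fin.ext (by simp; omega)
    rw [hpos i hi, h0, h.bottom]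
    congr 1
    omega

end IsChainPath

end Chain

/-- The shuffle placing the first chain below the second one. -/
def ShuffleT.leftFirst (a b : ℕ) : ShuffleT a b :=
  ⟨(Fin.castAdd b, Fin.natAdd a), fun _ _ h => h, fun _ _ h => by simpa using h,
    fun x => by
      refine Fin.addCases (fun i => Or.inl ⟨i, rfl⟩) (fun j => Or.inr ⟨j, rfl⟩) x⟩

/-- The shuffle placing the second chain below the first one. -/
def ShuffleT.rightFirst (a b : ℕ) : ShuffleT a b :=
  ⟨(fun i => ⟨b + i, by omega⟩, fun j => ⟨j, by omega⟩),
    fun i j h => by rw [Fin.lt_def] at h ⊢; simpa using h,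
    fun i j h => by rw [Fin.lt_def] at h ⊢; simpa using h,
    fun x => by
      rcases Nat.lt_or_ge x b with hx | hx
      · exact Or.inr ⟨⟨x, hx⟩, rfl⟩
      · exact Or.inl ⟨⟨x - b, by omega⟩, Fin.ext (by simp; omega)⟩⟩

/-- A shuffle is determined by any sequence on which its merged chain is strictly decreasing. -/
theorem ShuffleT.eq_of_strictAnti {a b : ℕ} {s₁ s₂ : ShuffleT a b} {A : Fin a → ℝ} {B : Fin b → ℝ}
    {f₁ f₂ : Fin (a + b) → ℝ} (h₁ : StrictAnti f₁) (h₂ : StrictAnti f₂)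
    (hA₁ : ∀ i, f₁ (s₁.1.1 i) = A i) (hB₁ : ∀ j, f₁ (s₁.1.2 j) = B j)
    (hA₂ : ∀ i, f₂ (s₂.1.1 i) = A i) (hB₂ : ∀ j, f₂ (s₂.1.2 j) = B j) : s₁ = s₂ := by
  have hrange : ∀ (s : ShuffleT a b) (f : Fin (a + b) → ℝ), (∀ i, f (s.1.1 i) = A i) →
      (∀ j, f (s.1.2 j) = B j) → Set.range (-f) = Set.range (-A) ∪ Set.range (-B) := by
    intro s f hA hB
    ext z
    simp only [Set.mem_range, Set.mem_union, Pi.neg_apply]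
    constructor
    · rintro ⟨x, rfl⟩
      rcases s.2.2.2 x with ⟨i, rfl⟩ | ⟨j, rfl⟩
      · exact Or.inl ⟨i, by rw [hA]⟩
      · exact Or.inr ⟨j, by rw [hB]⟩
    · rintro (⟨i, rfl⟩ | ⟨j, rfl⟩)
      · exact ⟨_, by rw [hA]⟩
      · exact ⟨_, by rw [hB]⟩
  have heq : -f₁ = -f₂ := (StrictMono.range_inj h₁.neg h₂.neg).1
    ((hrange s₁ f₁ hA₁ hB₁).trans (hrange s₂ f₂ hA₂ hB₂).symm)
  have hf : f₁ = f₂ := neg_injective heq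
  subst hf
  refine Subtype.ext (Prod.ext (funext fun i => ?_) (funext fun j => ?_))
  · exact h₁.injective (by rw [hA₁, hA₂])
  · exact h₁.injective (by rw [hB₁, hB₂])

/-- Two strictly decreasing sequences without common values merge into a strictly decreasing
sequence along some shuffle. -/
theorem ShuffleT.exists_strictAnti {a b : ℕ} {A : Fin a → ℝ} {B : Fin b → ℝ}
    (hA : StrictAnti A) (hB : StrictAnti B) (hne : ∀ i j, A i ≠ B j) :
    ∃ s : ShuffleT a b, ∀ f : Fin (a + b) → ℝ, (∀ i, f (s.1.1 i) = A i) →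
      (∀ j, f (s.1.2 j) = B j) → StrictAnti f := by
  classical
  let S : Finset ℝ := Finset.univ.image (fun i => -A i) ∪ Finset.univ.image (fun j => -B j)
  have hcard : S.card = a + b := by
    rw [Finset.card_union_of_disjoint, Finset.card_image_of_injective _ hA.neg.injective,
      Finset.card_image_of_injective _ hB.neg.injective, Finset.card_fin, Finset.card_fin]
    rw [Finset.disjoint_left]
    intro z hz hz'
    simp only [Finset.mem_image, Finset.mem_univ, true_and] at hz hz'
    obtain ⟨i, rfl⟩ := hz
    obtain ⟨j, hj⟩ := hz'
    exact hne i j (neg_injective hj.symm)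
  have hAS : ∀ i, -A i ∈ S := fun i => by simp [S]
  have hBS : ∀ j, -B j ∈ S := fun j => by simp [S]
  let e : Fin (a + b) ≃o S := S.orderIsoOfFin hcard
  refine ⟨⟨(fun i => e.symm ⟨-A i, hAS i⟩, fun j => e.symm ⟨-B j, hBS j⟩), ?_, ?_, ?_⟩, ?_⟩
  · exact fun i j h => e.symm.strictMono (hA.neg h)
  · exact fun i j h => e.symm.strictMono (hB.neg h)
  · intro x
    have hx := (e x).2
    simp only [S, Finset.mem_union, Finset.mem_image, Finset.mem_univ, true_and] at hx
    rcases hx with ⟨i, hi⟩ | ⟨j, hj⟩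
    · exact Or.inl ⟨i, (OrderIso.symm_apply_eq e).2 (Subtype.ext hi)⟩
    · exact Or.inr ⟨j, (OrderIso.symm_apply_eq e).2 (Subtype.ext hj)⟩
  · intro f hfA hfB
    have hf : ∀ x, f x = -(e x : ℝ) := by
      intro x
      have hx := (e x).2
      simp only [S, Finset.mem_union, Finset.mem_image, Finset.mem_univ, true_and] at hx
      rcases hx with ⟨i, hi⟩ | ⟨j, hj⟩
      · have : x = e.symm ⟨-A i, hAS i⟩ := ((OrderIso.symm_apply_eq e).2 (Subtype.ext hi)).symm
        rw [← hi, neg_neg]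
        exact (congrArg f this).trans (hfA i)
      · have : x = e.symm ⟨-B j, hBS j⟩ := ((OrderIso.symm_apply_eq e).2 (Subtype.ext hj)).symm
        rw [← hj, neg_neg]
        exact (congrArg f this).trans (hfB j)
    intro x y hxy
    rw [hf, hf]
    exact neg_lt_neg (e.strictMono hxy)

namespace ExoticTree

theorem mem_pair_iff (t : ExoticTree) (b v : Fin (t.n + 1)) :
    (t.mate v = b ∨ t.mate v = t.mate b) ↔ (v = b ∨ v = t.mate b) := by
  have h₁ : t.mate v = b ↔ v = t.mate b :=
    ⟨fun h => by rw [← h, t.mate_mate], fun h => by rw [h, t.mate_mate]⟩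
  have h₂ : t.mate v = t.mate b ↔ v = b :=
    ⟨fun h => by rw [← t.mate_mate v, h, t.mate_mate], fun h => by rw [h]⟩
  rw [h₁, h₂, or_comm]

/-- The merge `IsMergeAt` with its vertex identification `φ` and its merged path `ch` exposed. -/
structure IsMergeVia (t : ExoticTree) (b : Fin (t.n + 1)) (d₁ d₂ : ℕ)
    (sh : ShuffleT (d₁ - 1) (d₂ - 1)) (t' : ExoticTree) (φ : Fin (t.n + 1) → Fin (t'.n + 1))
    (ch : Fin (d₁ - 1 + (d₂ - 1) + 1) → Fin (t'.n + 1)) : Prop where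
  surjective : Function.Surjective φ
  map_zero : φ 0 = 0
  map_mate : φ b = φ (t.mate b)
  eq_or_of_map_eq : ∀ u v, φ u = φ v →
    u = v ∨ ((u = b ∨ u = t.mate b) ∧ (v = b ∨ v = t.mate b))
  colour_map : ∀ v, v ≠ b → v ≠ t.mate b → t'.colour (φ v) = t.colour v
  mate_map : ∀ v, v ≠ b → v ≠ t.mate b → t'.mate (φ v) = φ (t.mate v)
  mate_map_self : t'.mate (φ b) = φ b
  parent_map : ∀ v, v ≠ b → v ≠ t.mate b → ¬ t.OnClosingPath b d₁ d₂ v →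
    t'.parent (φ v) = φ (t.parent v)
  left : IsChainPath t'.parent ch (fun i => φ (t.parent^[i] b)) d₁ sh.1.1
  right : IsChainPath t'.parent ch (fun j => φ (t.parent^[j] (t.mate b))) d₂ sh.1.2

theorem IsMergeAt.exists_isMergeVia {t : ExoticTree} {b : Fin (t.n + 1)} {d₁ d₂ : ℕ}
    (hF : t.FirstCommon b d₁ d₂) {sh : ShuffleT (d₁ - 1) (d₂ - 1)} {t' : ExoticTree}
    (h : t.IsMergeAt b d₁ d₂ sh t') : ∃ φ ch, t.IsMergeVia b d₁ d₂ sh t' φ ch := by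
  obtain ⟨-, φ, h₁, h₂, h₃, h₄, h₅, -, h₆, h₇, h₈, ch, c₁, c₂, c₃, c₄, c₅⟩ := h
  exact ⟨φ, ch, h₁, h₂, h₃, h₄, h₅, h₆, h₇, h₈,
    ⟨hF.1, fun i j => sh.2.1 i j, c₃, c₂, c₁, c₄⟩,
    ⟨hF.2.1, fun i j => sh.2.2.1 i j, c₃, c₂.trans (congrArg φ hF.2.2.1), c₁.trans h₃, c₅⟩⟩

theorem _root_.Increasing.lt_iterate {t : ExoticTree} {c : Fin (t.n + 1) → ℝ}
    (h : Increasing 0 t.parent c) {v : Fin (t.n + 1)} (hv : v ≠ 0) {k : ℕ} (hk : 0 < k) :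
    c v < c (t.parent^[k] v) := by
  induction k, hk using Nat.le_induction with
  | base => exact h v hv
  | succ k _ ih =>
    rw [Function.iterate_succ_apply']
    by_cases h0 : t.parent^[k] v = 0
    · rwa [h0, t.parent_root, ← h0]
    · exact ih.trans (h _ h0)

namespace IsMergeVia

variable {t : ExoticTree} {b : Fin (t.n + 1)} {d₁ d₂ : ℕ} {sh : ShuffleT (d₁ - 1) (d₂ - 1)}
  {t' : ExoticTree} {φ : Fin (t.n + 1) → Fin (t'.n + 1)}
  {ch : Fin (d₁ - 1 + (d₂ - 1) + 1) → Fin (t'.n + 1)}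

theorem exists_iterate (h : t.IsMergeVia b d₁ d₂ sh t' φ ch) (v : Fin (t.n + 1)) :
    ∃ k, 0 < k ∧ t'.parent^[k] (φ v) = φ (t.parent v) := by
  have hL : ∀ i < d₁, ∃ k, 0 < k ∧
      t'.parent^[k] (φ (t.parent^[i] b)) = φ (t.parent (t.parent^[i] b)) := fun i hi => by
    rw [← Function.iterate_succ_apply' t.parent]; exact h.left.exists_iterate hi
  have hR : ∀ j < d₂, ∃ k, 0 < k ∧ t'.parent^[k] (φ (t.parent^[j] (t.mate b))) =
      φ (t.parent (t.parent^[j] (t.mate b))) := fun i hi => by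
    rw [← Function.iterate_succ_apply' t.parent]; exact h.right.exists_iterate hi
  by_cases hb : v = b
  · rw [hb]; exact hL 0 h.left.pos
  by_cases hm : v = t.mate b
  · rw [hm]; exact hR 0 h.right.pos
  by_cases hc : t.OnClosingPath b d₁ d₂ v
  · rcases hc with ⟨i, -, hi, rfl⟩ | ⟨j, -, hj, rfl⟩
    · exact hL i hi
    · exact hR j hj
  · exact ⟨1, one_pos, h.parent_map v hb hm hc⟩

theorem exists_iterate_iterate (h : t.IsMergeVia b d₁ d₂ sh t' φ ch) (v : Fin (t.n + 1)) (i : ℕ) :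
    ∃ k, t'.parent^[k] (φ v) = φ (t.parent^[i] v) := by
  induction i with
  | zero => exact ⟨0, rfl⟩
  | succ i ih =>
    obtain ⟨k, hk⟩ := ih
    obtain ⟨l, -, hl⟩ := h.exists_iterate (t.parent^[i] v)
    exact ⟨l + k, by
      rw [Function.iterate_add_apply, hk, hl, Function.iterate_succ_apply' t.parent]⟩

theorem map_eq_iff (h : t.IsMergeVia b d₁ d₂ sh t' φ ch) (u v : Fin (t.n + 1)) :
    φ u = φ v ↔ u = v ∨ ((u = b ∨ u = t.mate b) ∧ (v = b ∨ v = t.mate b)) := by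
  refine ⟨h.eq_or_of_map_eq u v, ?_⟩
  rintro (rfl | ⟨rfl | rfl, rfl | rfl⟩) <;> simp [h.map_mate]

theorem map_eq_zero_iff (h : t.IsMergeVia b d₁ d₂ sh t' φ ch)
    (hβ : t.colour b = some XColour.beta) (v : Fin (t.n + 1)) : φ v = 0 ↔ v = 0 := by
  have h₁ := t.ne_zero_of_colour hβ
  have h₂ := t.ne_zero_of_colour (t.mate_beta b hβ).1
  rw [← h.map_zero, h.map_eq_iff]
  simp [h₁.symm, h₂.symm]

theorem isLabelling (h : t.IsMergeVia b d₁ d₂ sh t' φ ch) (hβ : t.colour b = some XColour.beta)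
    {ι : Type*} {ℓ : Fin (t.n + 1) → Option ι} (hℓ : t.IsLabelling ℓ)
    {ℓ' : Fin (t'.n + 1) → Option ι} (hℓ' : ∀ v, ℓ' (φ v) = ℓ v) : t'.IsLabelling ℓ' where
  eq_none_iff w := by
    obtain ⟨v, rfl⟩ := h.surjective w
    rw [hℓ', hℓ.eq_none_iff, h.map_eq_zero_iff hβ]
  eq_iff w w' := by
    obtain ⟨u, rfl⟩ := h.surjective w
    obtain ⟨v, rfl⟩ := h.surjective w'
    rw [hℓ', hℓ', hℓ.eq_iff]
    by_cases hv : v = b ∨ v = t.mate b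
    · have h₁ : t'.mate (φ v) = φ v := by
        have : φ v = φ b := (h.map_eq_iff _ _).2 (Or.inr ⟨hv, Or.inl rfl⟩)
        rw [this, h.mate_map_self]
      rw [h₁, or_self, h.map_eq_iff]
      rcases hv with rfl | rfl
      · simp
      · rw [t.mate_mate]; tauto
    · have hv' := (not_congr (mem_pair_iff t b v)).2 hv
      rw [h.mate_map v (fun h => hv (Or.inl h)) (fun h => hv (Or.inr h)), h.map_eq_iff,
        h.map_eq_iff]
      simp [hv, hv']
  exists_eq_some i := by
    obtain ⟨v, hv⟩ := hℓ.exists_eq_some i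
    exact ⟨φ v, by rw [hℓ', hv]⟩

section Times

variable {c : Fin (t.n + 1) → ℝ} {c' : Fin (t'.n + 1) → ℝ}

theorem increasing_of_increasing (h : t.IsMergeVia b d₁ d₂ sh t' φ ch)
    (hβ : t.colour b = some XColour.beta) (hc : ∀ v, c' (φ v) = c v)
    (h' : Increasing 0 t'.parent c') : Increasing 0 t.parent c := by
  intro v hv
  obtain ⟨k, hk, hkv⟩ := h.exists_iterate v
  rw [← hc, ← hc, ← hkv]
  exact h'.lt_iterate ((not_congr (h.map_eq_zero_iff hβ v)).2 hv) hk

/-- If one of the closing paths is a single edge, the merge increases every time that the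
original tree does. -/
theorem increasing_of_eq_one (h : t.IsMergeVia b d₁ d₂ sh t' φ ch) (hd : d₁ = 1 ∨ d₂ = 1)
    (hc : ∀ v, c' (φ v) = c v) (hP : Increasing 0 t.parent c) : Increasing 0 t'.parent c' := by
  have hstep : ∀ w, ∃ v, φ v = w ∧ t'.parent w = φ (t.parent v) := by
    intro w
    obtain ⟨v, rfl⟩ := h.surjective w
    rcases hd with rfl | rfl
    · have hR : ∀ j < d₂, t'.parent (φ (t.parent^[j] (t.mate b))) =
          φ (t.parent (t.parent^[j] (t.mate b))) := fun j hj => by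
        rw [← Function.iterate_succ_apply' t.parent]
        exact h.right.apply_step_of_eq (by omega) hj
      by_cases hv : v = b ∨ v = t.mate b
      · have : φ v = φ (t.mate b) := (h.map_eq_iff _ _).2 (Or.inr ⟨hv, Or.inr rfl⟩)
        exact ⟨_, this.symm, by rw [this]; exact hR 0 h.right.pos⟩
      refine ⟨v, rfl, ?_⟩
      by_cases hcl : t.OnClosingPath b 1 d₂ v
      · rcases hcl with ⟨i, h₁, h₂, -⟩ | ⟨j, -, hj, rfl⟩
        · omega
        · exact hR j hj
      · exact h.parent_map v (fun h => hv (Or.inl h)) (fun h => hv (Or.inr h)) hcl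
    · have hL : ∀ i < d₁, t'.parent (φ (t.parent^[i] b)) =
          φ (t.parent (t.parent^[i] b)) := fun i hi => by
        rw [← Function.iterate_succ_apply' t.parent]
        exact h.left.apply_step_of_eq (by omega) hi
      by_cases hv : v = b ∨ v = t.mate b
      · have : φ v = φ b := (h.map_eq_iff _ _).2 (Or.inr ⟨hv, Or.inl rfl⟩)
        exact ⟨_, this.symm, by rw [this]; exact hL 0 h.left.pos⟩
      refine ⟨v, rfl, ?_⟩
      by_cases hcl : t.OnClosingPath b d₁ 1 v
      · rcases hcl with ⟨i, -, hi, rfl⟩ | ⟨j, h₁, h₂, -⟩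
        · exact hL i hi
        · omega
      · exact h.parent_map v (fun h => hv (Or.inl h)) (fun h => hv (Or.inr h)) hcl
  intro w hw
  obtain ⟨v, rfl, hv⟩ := hstep w
  rw [hv, hc, hc]
  exact hP v fun h0 => hw (by rw [h0, h.map_zero])

theorem castSucc_mem (h : t.IsMergeVia b d₁ d₂ sh t' φ ch) (k : Fin (d₁ - 1 + (d₂ - 1))) :
    (∃ i, 0 < i ∧ i < d₁ ∧ ch k.castSucc = φ (t.parent^[i] b)) ∨
      ∃ j, 0 < j ∧ j < d₂ ∧ ch k.castSucc = φ (t.parent^[j] (t.mate b)) := by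
  rcases sh.2.2.2 k with ⟨i, rfl⟩ | ⟨j, rfl⟩
  · exact Or.inl ⟨d₁ - 1 - i, by omega, by omega, h.left.eq i⟩
  · exact Or.inr ⟨d₂ - 1 - j, by omega, by omega, h.right.eq j⟩

theorem strictAnti_chain (h : t.IsMergeVia b d₁ d₂ sh t' φ ch)
    (hβ : t.colour b = some XColour.beta)
    (h0 : ∀ v, t.OnClosingPath b d₁ d₂ v → v ≠ 0) (hP : Increasing 0 t'.parent c') :
    StrictAnti fun k : Fin (d₁ - 1 + (d₂ - 1)) => c' (ch k.castSucc) := by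
  intro k l hkl
  have hl : ch l.castSucc ≠ 0 := by
    rcases h.castSucc_mem l with ⟨i, hi, hi', he⟩ | ⟨i, hi, hi', he⟩ <;>
      rw [he, Ne, h.map_eq_zero_iff hβ]
    · exact h0 _ (Or.inl ⟨i, hi, hi', rfl⟩)
    · exact h0 _ (Or.inr ⟨i, hi, hi', rfl⟩)
  have hlt : k.castSucc < l.castSucc := hkl
  simp only
  rw [← iterate_chain_of_le h.left.succ hlt.le]
  exact hP.lt_iterate hl (Nat.sub_pos_of_lt hlt)

theorem increasing_of_strictAnti (h : t.IsMergeVia b d₁ d₂ sh t' φ ch)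
    (hF : t.FirstCommon b d₁ d₂) (hβ : t.colour b = some XColour.beta)
    (h0 : ∀ v, t.OnClosingPath b d₁ d₂ v → v ≠ 0) (hc : ∀ v, c' (φ v) = c v)
    (hmate : c (t.mate b) = c b) (hP : Increasing 0 t.parent c)
    (hanti : StrictAnti fun k : Fin (d₁ - 1 + (d₂ - 1)) => c' (ch k.castSucc)) :
    Increasing 0 t'.parent c' := by
  have hb := t.ne_zero_of_colour hβ
  have hb' := t.ne_zero_of_colour (t.mate_beta b hβ).1
  have hgt : ∀ k : Fin (d₁ - 1 + (d₂ - 1)), c b < c' (ch k.castSucc) := by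
    intro k
    rcases h.castSucc_mem k with ⟨i, hi, -, he⟩ | ⟨i, hi, -, he⟩ <;> rw [he, hc]
    · exact hP.lt_iterate hb hi
    · rw [← hmate]; exact hP.lt_iterate hb' hi
  have hlt : ∀ k, c' (ch k) < c (t.parent^[d₁] b) := by
    intro k
    induction k using Fin.lastCases with
    | last => rw [h.left.top, hc]; exact hP.lt_iterate hb hF.1
    | cast k =>
      rcases h.castSucc_mem k with ⟨i, hi, hi', he⟩ | ⟨i, hi, hi', he⟩ <;> rw [he, hc]
      · obtain ⟨e, rfl⟩ := Nat.exists_eq_add_of_lt hi'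
        rw [show i + e + 1 = (e + 1) + i by omega, Function.iterate_add_apply]
        exact hP.lt_iterate (h0 _ (Or.inl ⟨i, hi, hi', rfl⟩)) (Nat.succ_pos e)
      · rw [hF.2.2.1]
        obtain ⟨e, rfl⟩ := Nat.exists_eq_add_of_lt hi'
        rw [show i + e + 1 = (e + 1) + i by omega, Function.iterate_add_apply]
        exact hP.lt_iterate (h0 _ (Or.inr ⟨i, hi, hi', rfl⟩)) (Nat.succ_pos e)
  have hchain : ∀ k, c' (ch k) < c' (t'.parent (ch k)) := by
    intro k
    induction k using Fin.cases with
    | zero => rw [h.left.bottom, hc]; exact hlt 0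
    | succ i =>
      rw [h.left.succ]
      by_cases hi : i.succ = Fin.last _
      · rw [hi, h.left.top, hc]; exact hgt i
      · obtain ⟨j, hj⟩ := Fin.exists_castSucc_eq.2 hi
        rw [← hj]
        refine hanti ?_
        have := congrArg Fin.val hj
        simp only [Fin.val_castSucc, Fin.val_succ] at this
        exact Fin.lt_def.2 (by omega)
  intro w hw
  obtain ⟨v, rfl⟩ := h.surjective w
  by_cases hv : v = b ∨ v = t.mate b
  · have : φ v = φ b := (h.map_eq_iff _ _).2 (Or.inr ⟨hv, Or.inl rfl⟩)
    have htop : ch (Fin.last _) = φ b := h.left.top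
    rw [this, ← htop]
    exact hchain _
  by_cases hcl : t.OnClosingPath b d₁ d₂ v
  · rcases hcl with ⟨i, -, hi, rfl⟩ | ⟨j, -, hj, rfl⟩
    · obtain ⟨k, hk⟩ := h.left.exists_pos hi
      rw [show φ _ = ch k from hk]; exact hchain k
    · obtain ⟨k, hk⟩ := h.right.exists_pos hj
      rw [show φ _ = ch k from hk]; exact hchain k
  · rw [h.parent_map v (fun h => hv (Or.inl h)) (fun h => hv (Or.inr h)) hcl, hc, hc]
    exact hP v ((not_congr (h.map_eq_zero_iff hβ v)).1 hw)

end Times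

end IsMergeVia

end ExoticTree

theorem ExoticTree.FirstCommon.ne_left {t : ExoticTree} {b : Fin (t.n + 1)} {d₁ d₂ : ℕ}
    (hF : t.FirstCommon b d₁ d₂) {i : ℕ} (hi : i < d₁) : t.parent^[i] b ≠ t.mate b :=
  hF.2.2.2 i hi 0 hF.2.1

theorem ExoticTree.FirstCommon.ne_right {t : ExoticTree} {b : Fin (t.n + 1)} {d₁ d₂ : ℕ}
    (hF : t.FirstCommon b d₁ d₂) {j : ℕ} (hj : j < d₂) : t.parent^[j] (t.mate b) ≠ b :=
  (hF.2.2.2 0 hF.1 j hj).symm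

theorem ExoticTree.FirstCommon.iterate_ne_mate {t : ExoticTree} {b : Fin (t.n + 1)} {d₁ d₂ : ℕ}
    (hF : t.FirstCommon b d₁ d₂) (hβ : t.colour b = some XColour.beta) (k : ℕ) :
    t.parent^[k] b ≠ t.mate b := by
  intro hk
  have hle : d₁ ≤ k := not_lt.1 fun hlt => hF.ne_left hlt hk
  obtain ⟨e, rfl⟩ := Nat.exists_eq_add_of_le' hle
  rw [Function.iterate_add_apply, hF.2.2.1, ← Function.iterate_add_apply] at hk
  exact t.ne_zero_of_colour (t.mate_beta b hβ).1
    (t.eq_zero_of_iterate_parent_eq_self (Nat.add_pos_right e hF.2.1) hk)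

theorem ExoticTree.FirstCommon.iterate_mate_ne {t : ExoticTree} {b : Fin (t.n + 1)} {d₁ d₂ : ℕ}
    (hF : t.FirstCommon b d₁ d₂) (hβ : t.colour b = some XColour.beta) (k : ℕ) :
    t.parent^[k] (t.mate b) ≠ b := by
  intro hk
  have hle : d₂ ≤ k := not_lt.1 fun hlt => hF.ne_right hlt hk
  obtain ⟨e, rfl⟩ := Nat.exists_eq_add_of_le' hle
  rw [Function.iterate_add_apply, ← hF.2.2.1, ← Function.iterate_add_apply] at hk
  exact t.ne_zero_of_colour hβ
    (t.eq_zero_of_iterate_parent_eq_self (Nat.add_pos_right e hF.1) hk)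

/-- In a reducible tree no β-vertex lies above its mate. -/
theorem IsReduction.iterate_ne_mate {t : ExoticTree} {M : Multiset PTree} (h : IsReduction t M) :
    ∀ v, t.colour v = some XColour.beta → ∀ k, t.parent^[k] v ≠ t.mate v := by
  induction h with
  | base t s h0 _ =>
    intro v hv
    rw [numBeta, Finset.card_eq_zero] at h0
    simpa [h0] using (Finset.mem_filter_univ (p := fun v => t.colour v = some XColour.beta) v).2 hv
  | merge t b d₁ d₂ hβ hnear next Ms hmerge _ ih =>
    intro v hv k hk
    by_cases hb : v = b
    · subst hb
      exact hnear.1.iterate_ne_mate hβ k hk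
    by_cases hm : v = t.mate b
    · subst hm
      rw [t.mate_mate] at hk
      exact hnear.1.iterate_mate_ne hβ k hk
    obtain ⟨φ, ch, h⟩ := (hmerge (ShuffleT.leftFirst _ _)).exists_isMergeVia hnear.1
    obtain ⟨l, hl⟩ := h.exists_iterate_iterate v k
    refine ih _ (φ v) (by rw [h.colour_map v hb hm, hv]) l ?_
    rw [hl, hk, h.mate_map v hb hm]

namespace ExoticTree

variable {t : ExoticTree} {b : Fin (t.n + 1)} {d₁ d₂ : ℕ}

/-- If both closing paths have internal vertices and every shuffle can be merged, then no internal
vertex is the root. -/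
theorem FirstCommon.ne_zero_of_onClosingPath (hF : t.FirstCommon b d₁ d₂)
    (hβ : t.colour b = some XColour.beta) (h₁ : d₁ ≠ 1) (h₂ : d₂ ≠ 1)
    (hmerge : ∀ sh, ∃ t', t.IsMergeAt b d₁ d₂ sh t') :
    ∀ v, t.OnClosingPath b d₁ d₂ v → v ≠ 0 := by
  have hd₁ := hF.1
  have hd₂ := hF.2.1
  rintro _ (⟨i, hi, hi', rfl⟩ | ⟨j, hj, hj', rfl⟩) h0
  · obtain ⟨t', ht'⟩ := hmerge (ShuffleT.rightFirst _ _)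
    obtain ⟨φ, ch, h⟩ := ht'.exists_isMergeVia hF
    obtain ⟨k, hk⟩ := h.left.exists_pos hi'
    simp only [h0, h.map_zero] at hk
    have hz := iterate_chain_of_le h.left.succ (Fin.zero_le k)
    rw [← hk, t'.iterate_parent_zero] at hz
    have he := h.right.eq ⟨0, by omega⟩
    have hidx : ((ShuffleT.rightFirst (d₁ - 1) (d₂ - 1)).1.2 ⟨0, by omega⟩).castSucc = 0 := rfl
    rw [hidx, ← hz, eq_comm, h.map_eq_zero_iff hβ] at he
    exact hF.2.2.2 i hi' (d₂ - 1 - 0) (by omega) (h0.trans he.symm)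
  · obtain ⟨t', ht'⟩ := hmerge (ShuffleT.leftFirst _ _)
    obtain ⟨φ, ch, h⟩ := ht'.exists_isMergeVia hF
    obtain ⟨k, hk⟩ := h.right.exists_pos hj'
    simp only [h0, h.map_zero] at hk
    have hz := iterate_chain_of_le h.left.succ (Fin.zero_le k)
    rw [← hk, t'.iterate_parent_zero] at hz
    have he := h.left.eq ⟨0, by omega⟩
    have hidx : ((ShuffleT.leftFirst (d₁ - 1) (d₂ - 1)).1.1 ⟨0, by omega⟩).castSucc = 0 := rfl
    rw [hidx, ← hz, eq_comm, h.map_eq_zero_iff hβ] at he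
    exact hF.2.2.2 (d₁ - 1 - 0) (by omega) j hj' (he.trans h0.symm)

/-- Internal vertices of the two closing paths are not mates of each other, provided that no
β-vertex of a merged tree lies above its mate. -/
theorem FirstCommon.iterate_ne_mate_iterate (hF : t.FirstCommon b d₁ d₂)
    (hβ : t.colour b = some XColour.beta) {sh : ShuffleT (d₁ - 1) (d₂ - 1)} {t' : ExoticTree}
    (hmerge : t.IsMergeAt b d₁ d₂ sh t')
    (hmates : ∀ v, t'.colour v = some XColour.beta → ∀ k, t'.parent^[k] v ≠ t'.mate v)
    {i j : ℕ} (hi : 0 < i) (hi' : i < d₁) (hj : 0 < j) (hj' : j < d₂) :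
    t.parent^[i] b ≠ t.mate (t.parent^[j] (t.mate b)) := by
  intro heq
  obtain ⟨φ, ch, h⟩ := hmerge.exists_isMergeVia hF
  obtain ⟨k, hk⟩ := h.left.exists_pos hi'
  obtain ⟨l, hl⟩ := h.right.exists_pos hj'
  have hne := hF.2.2.2 i hi' j hj'
  have hub : t.parent^[i] b ≠ b := fun h =>
    t.ne_zero_of_colour hβ (t.eq_zero_of_iterate_parent_eq_self hi h)
  have hum := hF.ne_left hi'
  have hvb := hF.ne_right hj'
  have hvm : t.parent^[j] (t.mate b) ≠ t.mate b := fun h =>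
    t.ne_zero_of_colour (t.mate_beta b hβ).1 (t.eq_zero_of_iterate_parent_eq_self hj h)
  generalize t.parent^[i] b = u at *
  generalize t.parent^[j] (t.mate b) = v at *
  have hv : t.colour v = some XColour.beta := by
    by_contra hv
    exact hne (heq.trans (t.mate_nonbeta v hv))
  have hu : t.colour u = some XColour.beta := by rw [heq, t.colour_mate_eq_beta_iff, hv]
  have hmu : t'.mate (φ u) = φ v := by rw [h.mate_map u hub hum, heq, t.mate_mate]
  have hmv : t'.mate (φ v) = φ u := by rw [h.mate_map v hvb hvm, heq]
  rcases le_total k l with hkl | hkl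
  · refine hmates (φ v) (by rw [h.colour_map v hvb hvm, hv]) (l - k) ?_
    rw [hmv, hk, hl]
    exact iterate_chain_of_le h.left.succ hkl
  · refine hmates (φ u) (by rw [h.colour_map u hub hum, hu]) (k - l) ?_
    rw [hmu, hk, hl]
    exact iterate_chain_of_le h.left.succ hkl

theorem _root_.ShuffleT.eq_of_eq_one (h : d₁ = 1 ∨ d₂ = 1) (s₁ s₂ : ShuffleT (d₁ - 1) (d₂ - 1)) :
    s₁ = s₂ := by
  have hL : ∀ i, s₁.1.1 i = s₂.1.1 i := fun i => by
    rcases h with rfl | rfl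
    · exact i.elim0
    · exact Fin.ext ((val_eq_of_strictMono (by omega) (s₁.2.1 · ·) i).trans
        (val_eq_of_strictMono (by omega) (s₂.2.1 · ·) i).symm)
  have hR : ∀ i, s₁.1.2 i = s₂.1.2 i := fun i => by
    rcases h with rfl | rfl
    · exact Fin.ext ((val_eq_of_strictMono (by omega) (s₁.2.2.1 · ·) i).trans
        (val_eq_of_strictMono (by omega) (s₂.2.2.1 · ·) i).symm)
    · exact i.elim0
  exact Subtype.ext (Prod.ext (funext hL) (funext hR))

theorem _root_.Increasing.strictAnti_iterate {c : Fin (t.n + 1) → ℝ}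
    (hP : Increasing 0 t.parent c) {u : Fin (t.n + 1)} {d : ℕ}
    (h0 : ∀ i, 0 < i → i < d → t.parent^[i] u ≠ 0) :
    StrictAnti fun i : Fin (d - 1) => c (t.parent^[d - 1 - i] u) := by
  intro i j hij
  have hij' : (i : ℕ) < j := hij
  simp only
  rw [show d - 1 - (i : ℕ) = (j - i) + (d - 1 - j) by omega, Function.iterate_add_apply]
  exact hP.lt_iterate (h0 _ (by omega) (by omega)) (by omega)

/-- Merging a closed branch along all shuffles of its closing paths preserves the realization. -/
theorem realize_eq_sum (hF : t.FirstCommon b d₁ d₂) (hβ : t.colour b = some XColour.beta)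
    (next : ShuffleT (d₁ - 1) (d₂ - 1) → ExoticTree)
    (hmerge : ∀ sh, t.IsMergeAt b d₁ d₂ sh (next sh))
    (hmates : ∀ sh v, (next sh).colour v = some XColour.beta →
      ∀ k, (next sh).parent^[k] v ≠ (next sh).mate v) (T x : ℝ) :
    t.realize T x = ∑ sh, (next sh).realize T x := by
  choose φ ch h using fun sh => (hmerge sh).exists_isMergeVia hF
  have hℓ := t.isLabelling_label
  let ℓ' : ∀ sh, Fin ((next sh).n + 1) → Option {v : Fin (t.n + 1) // v ∈ t.itemSet} :=
    fun sh w => t.label (Function.surjInv (h sh).surjective w)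
  have hℓ' : ∀ sh v, ℓ' sh (φ sh v) = t.label v := by
    intro sh v
    rw [hℓ.eq_iff]
    have := ((h sh).map_eq_iff _ _).1 (Function.surjInv_eq (h sh).surjective (φ sh v))
    generalize Function.surjInv (h sh).surjective (φ sh v) = u at this ⊢
    rcases this with rfl | ⟨rfl | rfl, rfl | rfl⟩ <;> simp [t.mate_mate]
  rw [t.realize_eq_labelIntegral hℓ, Finset.sum_congr rfl fun sh _ =>
    (next sh).realize_eq_labelIntegral ((h sh).isLabelling hβ hℓ (hℓ' sh)) T x]
  refine labelIntegral_eq_sum (W := fun sh => Fin ((next sh).n + 1)) _ _ _ _ _ _ _ _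
    fun y hy => ?_
  have hc : ∀ sh v, labelTime (ℓ' sh) x y (φ sh v) = labelTime t.label x y v := fun sh v => by
    simp only [labelTime, hℓ']
  have hmate : labelTime t.label x y (t.mate b) = labelTime t.label x y b := by
    simp only [labelTime, (hℓ.eq_iff (t.mate b) b).2 (Or.inr rfl)]
  have hinj : ∀ u v, u ≠ 0 → v ≠ 0 → labelTime t.label x y u = labelTime t.label x y v →
      u = v ∨ u = t.mate v := by
    intro u v hu hv huv
    obtain ⟨i, hi⟩ := Option.ne_none_iff_exists'.1 ((not_congr (hℓ.eq_none_iff u)).2 hu)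
    obtain ⟨j, hj⟩ := Option.ne_none_iff_exists'.1 ((not_congr (hℓ.eq_none_iff v)).2 hv)
    simp only [labelTime, hi, hj, Option.elim] at huv
    rw [← hℓ.eq_iff, hi, hj, hy huv]
  by_cases hd : d₁ = 1 ∨ d₂ = 1
  · exact ⟨fun hP => ⟨ShuffleT.leftFirst _ _, (h _).increasing_of_eq_one hd (hc _) hP⟩,
      fun sh => (h sh).increasing_of_increasing hβ (hc sh),
      fun s₁ s₂ _ _ => ShuffleT.eq_of_eq_one hd s₁ s₂⟩
  rw [not_or] at hd
  have h0 := hF.ne_zero_of_onClosingPath hβ hd.1 hd.2 fun sh => ⟨_, hmerge sh⟩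
  refine ⟨fun hP => ?_, fun sh => (h sh).increasing_of_increasing hβ (hc sh),
    fun s₁ s₂ hP₁ hP₂ => ?_⟩
  · obtain ⟨sh, hsh⟩ := ShuffleT.exists_strictAnti
      (hP.strictAnti_iterate fun i hi hi' => h0 _ (Or.inl ⟨i, hi, hi', rfl⟩))
      (hP.strictAnti_iterate fun j hj hj' => h0 _ (Or.inr ⟨j, hj, hj', rfl⟩))
      (fun i j heq => by
        have hi : 0 < d₁ - 1 - (i : ℕ) ∧ d₁ - 1 - (i : ℕ) < d₁ := by omega
        have hj : 0 < d₂ - 1 - (j : ℕ) ∧ d₂ - 1 - (j : ℕ) < d₂ := by omega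
        rcases hinj _ _ (h0 _ (Or.inl ⟨_, hi.1, hi.2, rfl⟩))
          (h0 _ (Or.inr ⟨_, hj.1, hj.2, rfl⟩)) heq with h' | h'
        · exact hF.2.2.2 _ hi.2 _ hj.2 h'
        · exact hF.iterate_ne_mate_iterate hβ (hmerge (ShuffleT.leftFirst _ _)) (hmates _)
            hi.1 hi.2 hj.1 hj.2 h')
    refine ⟨sh, (h sh).increasing_of_strictAnti hF hβ h0 (hc sh) hmate hP (hsh _ ?_ ?_)⟩
    · intro i
      rw [(h sh).left.eq, hc]
    · intro j
      rw [(h sh).right.eq, hc]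
  · refine ShuffleT.eq_of_strictAnti ((h s₁).strictAnti_chain hβ h0 hP₁)
      ((h s₂).strictAnti_chain hβ h0 hP₂)
      (A := fun i => labelTime t.label x y (t.parent^[d₁ - 1 - i] b))
      (B := fun j => labelTime t.label x y (t.parent^[d₂ - 1 - j] (t.mate b))) ?_ ?_ ?_ ?_
    · intro i; rw [(h s₁).left.eq, hc]
    · intro j; rw [(h s₁).right.eq, hc]
    · intro i; rw [(h s₂).left.eq, hc]
    · intro j; rw [(h s₂).right.eq, hc]

end ExoticTree

theorem IsReduction.realize_eq_sum {t : ExoticTree} {M : Multiset PTree} (h : IsReduction t M)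
    (T x : ℝ) : t.realize T x = (M.map fun s => s.realize T x).sum := by
  induction h with
  | base t s h0 hiso =>
    obtain ⟨e, he, hp⟩ := hiso
    simpa using t.realize_eq_of_numBeta_eq_zero s h0 e he hp T x
  | merge t b d₁ d₂ hβ hnear next Ms hmerge hnext ih =>
    rw [ExoticTree.realize_eq_sum hnear.1 hβ next hmerge
      (fun sh => (hnext sh).iterate_ne_mate), Finset.sum_congr rfl fun sh _ => ih sh]
    rw [← Multiset.coe_mapAddMonoidHom, map_sum, Multiset.sum_sum]

/-- Fix `T > 0`.  For every exotic coloured tree `τ` whose graph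
obtained by identifying each β-pair to a single vertex is acyclic, and every
`t ∈ [0, T]`, `Π^e_t(τ) = Σ_{τ̄ ∈ R(τ)} Π_t(τ̄)`, the sum running with multiplicity
over the reduction multiset `R(τ)`, where `Π_t(τ̄)` is the iterated Heaviside integral
of the uncoloured rooted tree `τ̄`. -/
theorem stmt11 (T : ℝ) (hT : 0 < T) (t : ExoticTree) (hacyc : t.IdAcyclic)
    (M : Multiset PTree) (hred : IsReduction t M)
    (x : ℝ) (hx : x ∈ Set.Icc (0 : ℝ) T) :
    t.realize T x = (M.map fun s => s.realize T x).sum := by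
  exact hred.realize_eq_sum T x
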